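/- arXiv:0809.4785 — 2 statements merged into one kernel-verified Lean document; each statement's English description precedes it below -/
import Mathlib

section
/- Let A be an abelian category and A⁰ ← A¹ ← ... ← A^{r-1} ← A^r = 0 a finite sequence of objects and morphisms in the bounded derived category D^b(A). Then there exist a bounded complex K in A with a finite filtration by subcomplexes K = F⁰K ⊇ F¹K ⊇ ... ⊇ F^r K = 0 and quasi-isomorphisms u_p : F^p K → A^p in the category of complexes such that for every p the square formed by the inclusion F^{p+1}K ↪ F^p K, the maps u_p, u_{p+1}, and the given morphism A^{p+1} → A^p commutes in D^b(A). -/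
/-!
STATEMENT 8: Let `A` be an abelian category and `A⁰ ← A¹ ← ... ← A^{r-1} ← A^r = 0`
a finite sequence of objects and morphisms in `D^b(A)`.  Then there exist a
bounded complex `K` in `A` with a finite filtration by subcomplexes
`K = F⁰K ⊇ F¹K ⊇ ... ⊇ F^rK = 0` and quasi-isomorphisms `u_p : F^pK → A^p`
(morphisms of complexes) such that all squares formed by the inclusions
`F^{p+1}K ↪ F^pK`, the quasi-isomorphisms `u_p` and the given morphisms
`A^{p+1} → A^p` commute in `D^b(A)`.

Objects of `D^b(A)` are represented by bounded cochain complexes `Aobj p`,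
morphisms `A^{p+1} → A^p` by morphisms `a p` in the derived category between
their images under the localization functor `Q`; "subcomplex" is expressed by
degreewise monomorphisms.
-/

open CategoryTheory Limits

namespace CochainComplex

variable {C : Type*} [Category C] [Abelian C]

/-- A cochain complex is bounded if it vanishes outside of a finite range of degrees. -/
def IsBounded (K : CochainComplex C ℤ) : Prop :=
  ∃ n₀ n₁ : ℤ, ∀ i : ℤ, (i < n₀ ∨ n₁ < i) → IsZero (K.X i)

/-- The second projection `mappingCone (𝟙 K) ⊞ L ⟶ L` is a homotopy equivalence. -/
noncomputable def mappingConeIdBiprodHomotopyEquiv (K L : CochainComplex C ℤ) :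
    HomotopyEquiv (mappingCone (𝟙 K) ⊞ L) L where
  hom := biprod.snd
  inv := biprod.inr
  homotopyHomInvId :=
    let h₁ := ((mappingCone.homotopyToZeroOfId K).compRight
      (biprod.inl : _ ⟶ mappingCone (𝟙 K) ⊞ L)).compLeft
        (biprod.fst : mappingCone (𝟙 K) ⊞ L ⟶ _)
    let h₂ := Homotopy.add h₁ (Homotopy.refl (biprod.snd ≫ biprod.inr))
    (Homotopy.ofEq (by simp)).trans (h₂.symm.trans (Homotopy.ofEq (by simp)))
  homotopyInvHomId := Homotopy.ofEq (by simp)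

lemma IsBounded.mappingCone_id_biprod {K L : CochainComplex C ℤ}
    (hK : K.IsBounded) (hL : L.IsBounded) : (mappingCone (𝟙 K) ⊞ L).IsBounded := by
  obtain ⟨a, b, hK⟩ := hK
  obtain ⟨c, d, hL⟩ := hL
  refine ⟨min (a - 1) c, max b d, fun i hi ↦ ?_⟩
  refine IsZero.of_iso ?_ ((HomologicalComplex.eval C (ComplexShape.up ℤ) i).mapBiprod _ _)
  simp only [HomologicalComplex.eval_obj, biprod_isZero_iff, mappingCone.isZero_X_iff]
  exact ⟨⟨hK _ (by lia), hK _ (by lia)⟩, hL _ (by lia)⟩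

/-- A morphism between bounded complexes factors as a degreewise monomorphism followed
by a quasi-isomorphism, through a bounded complex. -/
lemma IsBounded.exists_mono_quasiIso_fac {K L : CochainComplex C ℤ}
    (hK : K.IsBounded) (hL : L.IsBounded) (f : K ⟶ L) :
    ∃ (M : CochainComplex C ℤ) (i : K ⟶ M) (p : M ⟶ L),
      M.IsBounded ∧ (∀ n, Mono (i.f n)) ∧ QuasiIso p ∧ i ≫ p = f := by
  refine ⟨_, biprod.lift (mappingCone.inr (𝟙 K)) f, biprod.snd,
    hK.mappingCone_id_biprod hL, fun n ↦ ?_,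
    (mappingConeIdBiprodHomotopyEquiv K L).quasiIso_hom, by simp⟩
  have h : (biprod.lift (mappingCone.inr (𝟙 K)) f).f n ≫
      (biprod.fst : mappingCone (𝟙 K) ⊞ L ⟶ _).f n ≫
        (mappingCone.snd (𝟙 K)).v n n (add_zero n) = 𝟙 _ := by
    rw [← HomologicalComplex.comp_f_assoc, biprod.lift_fst]
    simp
  exact mono_of_mono_fac h

end CochainComplex

namespace DerivedCategory

variable {C : Type*} [Category C] [Abelian C] [HasDerivedCategory C]

/-- A morphism in the derived category between bounded complexes is represented by a
right fraction whose apex is a bounded complex, which is zero if the source is. -/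
lemma exists_bounded_right_fac {X Y : CochainComplex C ℤ} (hX : X.IsBounded)
    (hY : Y.IsBounded) (φ : Q.obj X ⟶ Q.obj Y) :
    ∃ (B : CochainComplex C ℤ) (s : B ⟶ X) (f : B ⟶ Y), B.IsBounded ∧
      ((∀ i, IsZero (X.X i)) → ∀ i, IsZero (B.X i)) ∧ QuasiIso s ∧
      Q.map f = Q.map s ≫ φ := by
  by_cases h : ∀ i, IsZero (X.X i)
  · have hX₀ : IsZero X := by
      rw [IsZero.iff_id_eq_zero]
      ext i
      exact (h i).eq_of_src _ _
    exact ⟨X, 𝟙 X, 0, hX, fun h ↦ h, inferInstance, (Q.map_isZero hX₀).eq_of_src _ _⟩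
  · obtain ⟨a, b, hX⟩ := hX
    obtain ⟨c, d, hY⟩ := hY
    have : X.IsStrictlyGE (min a c) :=
      (X.isStrictlyGE_iff _).2 fun i hi ↦ hX i (by lia)
    have : Y.IsStrictlyGE (min a c) :=
      (Y.isStrictlyGE_iff _).2 fun i hi ↦ hY i (by lia)
    have : X.IsStrictlyLE b := (X.isStrictlyLE_iff _).2 fun i hi ↦ hX i (by lia)
    obtain ⟨B, _, _, s, hs, f, rfl⟩ :=
      right_fac_of_isStrictlyLE_of_isStrictlyGE (min a c) b φ
    refine ⟨B, s, f, ⟨min a c, b, ?_⟩, fun h' ↦ (h h').elim,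
      (isIso_Q_map_iff_quasiIso _ s).1 hs, by simp⟩
    rintro i (hi | hi)
    · exact B.isZero_of_isStrictlyGE _ i hi
    · exact B.isZero_of_isStrictlyLE _ i hi

/-- A finite sequence of morphisms in the derived category between bounded complexes is
represented by a filtered bounded complex, compatibly with a morphism `φ` out of its first term. -/
lemma exists_filtration (r : ℕ) (K : Fin (r + 1) → CochainComplex C ℤ)
    (hK : ∀ p, (K p).IsBounded)
    (a : ∀ p : Fin r, Q.obj (K p.succ) ⟶ Q.obj (K p.castSucc))
    (X : CochainComplex C ℤ) (hX : X.IsBounded) (φ : Q.obj (K 0) ⟶ Q.obj X) :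
    ∃ (F : Fin (r + 1) → CochainComplex C ℤ) (i : ∀ p : Fin r, F p.succ ⟶ F p.castSucc)
      (u : ∀ p, F p ⟶ K p) (v : F 0 ⟶ X),
      (∀ p, (F p).IsBounded) ∧ (∀ p n, Mono ((i p).f n)) ∧
      ((∀ n, IsZero ((K (Fin.last r)).X n)) → ∀ n, IsZero ((F (Fin.last r)).X n)) ∧
      (∀ p, QuasiIso (u p)) ∧
      (∀ p : Fin r, Q.map (i p) ≫ Q.map (u p.castSucc) = Q.map (u p.succ) ≫ a p) ∧
      Q.map v = Q.map (u 0) ≫ φ := by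
  induction r generalizing X with
  | zero =>
    obtain ⟨B, s, f, hB, hB₀, hs, fac⟩ := exists_bounded_right_fac (hK 0) hX φ
    let u (q : Fin 1) : B ⟶ K q :=
      Fin.cases (motive := fun q ↦ B ⟶ K q) s (fun p ↦ p.elim0) q
    exact ⟨fun _ ↦ B, fun p ↦ p.elim0, u, f, fun _ ↦ hB, fun p ↦ p.elim0, hB₀,
      Fin.cases hs fun p ↦ p.elim0, fun p ↦ p.elim0, fac⟩
  | succ r ih =>
    obtain ⟨B, s, f, hB, -, hs, fac⟩ := exists_bounded_right_fac (hK 0) hX φ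
    have : IsIso (Q.map s) := (isIso_Q_map_iff_quasiIso _ s).2 hs
    let a₀ : Q.obj (K (Fin.succ 0)) ⟶ Q.obj (K 0) := a 0
    have ha₀ : (a₀ ≫ inv (Q.map s)) ≫ Q.map s = a₀ :=
      (IsIso.eq_comp_inv (Q.map s)).1 rfl
    obtain ⟨F, i, u, v, hF, hi, hF₀, hu, comm, hv⟩ :=
      ih (fun p ↦ K p.succ) (fun p ↦ hK p.succ) (fun p ↦ a p.succ) B hB
        (a₀ ≫ inv (Q.map s))
    obtain ⟨M, j, p, hM, hj, hp, rfl⟩ := (hF 0).exists_mono_quasiIso_fac hB v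
    let F' : Fin (r + 2) → CochainComplex C ℤ := Fin.cons M F
    let i' (q : Fin (r + 1)) : F' q.succ ⟶ F' q.castSucc :=
      Fin.cases (motive := fun q ↦ F' q.succ ⟶ F' q.castSucc) j i q
    let u' (q : Fin (r + 2)) : F' q ⟶ K q :=
      Fin.cases (motive := fun q ↦ F' q ⟶ K q) (p ≫ s) u q
    refine ⟨F', i', u', p ≫ f, Fin.cases hM hF, Fin.cases hj hi, hF₀,
      Fin.cases (quasiIso_comp p s) hu, Fin.cases ?_ comm, ?_⟩
    · change Q.map (p ≫ f) = Q.map (p ≫ s) ≫ φ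
      simp [fac]
    · change Q.map j ≫ Q.map (p ≫ s) = Q.map (u 0) ≫ a₀
      rw [Q.map_comp p s, ← Category.assoc, ← Q.map_comp, hv]
      exact (Category.assoc _ _ _).trans (congrArg (Q.map (u 0) ≫ ·) ha₀)

end DerivedCategory

theorem statement8 {A : Type*} [Category A] [Abelian A] [HasDerivedCategory A]
    (r : ℕ)
    -- the objects `A⁰, ..., A^r` of `D^b(A)`, represented by bounded complexes:
    (Aobj : Fin (r + 1) → CochainComplex A ℤ)
    (hboundedA : ∀ p, ∃ n₀ n₁ : ℤ, ∀ i : ℤ, (i < n₀ ∨ n₁ < i) → IsZero ((Aobj p).X i))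
    -- `A^r = 0`:
    (hzero : ∀ i : ℤ, IsZero ((Aobj (Fin.last r)).X i))
    -- the morphisms `A^{p+1} → A^p` in `D^b(A)`:
    (a : ∀ p : Fin r,
      DerivedCategory.Q.obj (Aobj p.succ) ⟶ DerivedCategory.Q.obj (Aobj p.castSucc)) :
    -- conclusion: a filtered bounded complex `K = F 0 ⊇ F 1 ⊇ ... ⊇ F r = 0`
    -- with quasi-isomorphisms `u p : F p ⟶ A^p` making the squares commute
    -- in the derived category.
    ∃ (F : Fin (r + 1) → CochainComplex A ℤ)
      (incl : ∀ p : Fin r, F p.succ ⟶ F p.castSucc)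
      (u : ∀ p : Fin (r + 1), F p ⟶ Aobj p),
      -- `K := F 0` is a bounded complex:
      (∀ p, ∃ n₀ n₁ : ℤ, ∀ i : ℤ, (i < n₀ ∨ n₁ < i) → IsZero ((F p).X i))
      -- the filtration is by subcomplexes (degreewise monomorphisms):
      ∧ (∀ (p : Fin r) (i : ℤ), Mono ((incl p).f i))
      -- `F^r K = 0`:
      ∧ (∀ i : ℤ, IsZero ((F (Fin.last r)).X i))
      -- the `u p` are quasi-isomorphisms of complexes:
      ∧ (∀ p, QuasiIso (u p))
      -- the squares commute in the derived category:
      ∧ (∀ p : Fin r,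
          DerivedCategory.Q.map (incl p) ≫ DerivedCategory.Q.map (u p.castSucc) =
            DerivedCategory.Q.map (u p.succ) ≫ a p) := by
  obtain ⟨F, i, u, -, hF, hi, hF₀, hu, comm, -⟩ :=
    DerivedCategory.exists_filtration r Aobj hboundedA a (Aobj 0) (hboundedA 0) (𝟙 _)
  exact ⟨F, i, u, hF, hi, hF₀ hzero, hu, comm⟩
end

section
/- Let A, B be abelian categories, F : D^b(A) → D^b(B) a triangulated functor, and 0 → P^{-n} → ... → P^{-1} → P^0 → M → 0 a bounded exact complex in A. Assume F(P^i) lies in the heart B (i.e. is concentrated in degree 0) for all i. Let F̂(P) be the complex ... → 0 → F(P^{-n}) → ... → F(P^0) → 0 → ... obtained by applying F to the differentials. Then F(M) ≅ F̂(P) in D^b(B). -/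
/-!
STATEMENT 11: Let `A`, `B` be abelian categories, `F : D^b(A) → D^b(B)` a
triangulated functor, and `0 → P^{-n} → ... → P^{-1} → P⁰ → M → 0` a bounded
exact complex in `A` (a resolution of `M`, encoded by a bounded complex `P`
concentrated in degrees `[-n, 0]` with a quasi-isomorphism `ε : P ⟶ M[0]`).
Assume `F(P^i)` lies in the heart `B` (i.e. is isomorphic to an object of `B`
placed in degree `0`) for all `i`.  Let `F̂(P)` be the complex
`... → 0 → F(P^{-n}) → ... → F(P⁰) → 0 → ...` in `B` obtained by applying `F`
to the differentials.  Then `F(M) ≅ F̂(P)` in `D^b(B)`.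
-/

open CategoryTheory Limits

namespace CochainComplex

variable {C : Type*} [Category C] [Abelian C]

/-- The inclusion of the degree zero term in a complex concentrated in nonpositive degrees. -/
noncomputable def fromSingleZero (P : CochainComplex C ℤ) (hP : ∀ i : ℤ, 0 < i → IsZero (P.X i)) :
    (HomologicalComplex.single C (ComplexShape.up ℤ) 0).obj (P.X 0) ⟶ P :=
  HomologicalComplex.mkHomFromSingle (𝟙 _) (fun k hk =>
    (hP k (by simp at hk; lia)).eq_of_tgt _ _)

lemma fromSingleZero_f_zero (P : CochainComplex C ℤ) (hP : ∀ i : ℤ, 0 < i → IsZero (P.X i)) :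
    (fromSingleZero P hP).f 0 =
      (HomologicalComplex.singleObjXSelf (ComplexShape.up ℤ) 0 (P.X 0)).hom := by
  simp [fromSingleZero]

lemma isZero_single_X (X : C) (i : ℤ) (hi : i ≠ 0) :
    IsZero (((HomologicalComplex.single C (ComplexShape.up ℤ) 0).obj X).X i) :=
  HomologicalComplex.isZero_single_obj_X _ _ _ _ hi

/-- The brutal truncation in degrees `< 0`, shifted to the right by one. -/
noncomputable def negPart (P : CochainComplex C ℤ) (hP : ∀ i : ℤ, 0 < i → IsZero (P.X i)) :
    CochainComplex C ℤ where
  X p := cokernel ((fromSingleZero P hP).f (p - 1))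
  d p q := -cokernel.map _ _ (HomologicalComplex.d _ (p - 1) (q - 1)) (P.d (p - 1) (q - 1))
    ((fromSingleZero P hP).comm _ _)
  shape p q h := by
    rw [neg_eq_zero, ← cancel_epi (cokernel.π _), cokernel.π_desc, comp_zero,
      P.shape _ _ (fun h' => h (by simp at h' ⊢; lia)), zero_comp]
  d_comp_d' p q r _ _ := by
    rw [← cancel_epi (cokernel.π _)]
    simp

/-- The projection to `negPart`. -/
noncomputable def toNegPart (P : CochainComplex C ℤ) (hP : ∀ i : ℤ, 0 < i → IsZero (P.X i))
    (p : ℤ) : P.X (p - 1) ⟶ (negPart P hP).X p :=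
  cokernel.π _

instance (P : CochainComplex C ℤ) (hP : ∀ i : ℤ, 0 < i → IsZero (P.X i)) (p : ℤ) :
    Epi (toNegPart P hP p) :=
  inferInstanceAs (Epi (cokernel.π ((fromSingleZero P hP).f (p - 1))))

lemma toNegPart_d (P : CochainComplex C ℤ) (hP : ∀ i : ℤ, 0 < i → IsZero (P.X i)) (p q : ℤ) :
    toNegPart P hP p ≫ (negPart P hP).d p q = -P.d (p - 1) (q - 1) ≫ toNegPart P hP q := by
  have h := cokernel.π_desc ((fromSingleZero P hP).f (p - 1))
    (P.d (p - 1) (q - 1) ≫ cokernel.π ((fromSingleZero P hP).f (q - 1))) (by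
      rw [HomologicalComplex.Hom.comm_assoc, cokernel.condition, comp_zero])
  exact (Preadditive.comp_neg _ _).trans (congrArg Neg.neg h)

lemma isIso_toNegPart (P : CochainComplex C ℤ) (hP : ∀ i : ℤ, 0 < i → IsZero (P.X i)) (p : ℤ)
    (hp : p ≠ 1) : IsIso (toNegPart P hP p) := by
  have isIso_π {X Y : C} (f : X ⟶ Y) (hf : f = 0) : IsIso (cokernel.π f) := by
    subst hf
    infer_instance
  exact isIso_π ((fromSingleZero P hP).f (p - 1))
    ((isZero_single_X _ _ (by lia)).eq_of_src _ _)

lemma isZero_negPart_X (P : CochainComplex C ℤ) (hP : ∀ i : ℤ, 0 < i → IsZero (P.X i)) (p : ℤ)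
    (hp : 0 < p) : IsZero ((negPart P hP).X p) := by
  rw [IsZero.iff_id_eq_zero, ← cancel_epi (toNegPart P hP p)]
  by_cases h : p = 1
  · subst h
    have : Epi ((fromSingleZero P hP).f (1 - 1)) := by
      change Epi ((fromSingleZero P hP).f 0)
      rw [fromSingleZero_f_zero]
      infer_instance
    have h : toNegPart P hP 1 = 0 := by
      rw [← cancel_epi ((fromSingleZero P hP).f (1 - 1)), comp_zero]
      exact cokernel.condition _
    simp [h]
  · exact (hP _ (by lia)).eq_of_src _ _

lemma exists_mappingCone_iso (P : CochainComplex C ℤ)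
    (hP : ∀ i : ℤ, 0 < i → IsZero (P.X i)) :
    ∃ (R : CochainComplex C ℤ) (α : ∀ p, R.X p ⟶ P.X (p - 1))
      (f : R ⟶ (HomologicalComplex.single C (ComplexShape.up ℤ) 0).obj (P.X 0))
      (g : mappingCone f ≅ P),
      (∀ p, 0 < p → IsZero (R.X p)) ∧ (∀ p, p ≤ 0 → IsIso (α p)) ∧
      (∀ p q, p ≤ 0 → q ≤ 0 → R.d p q ≫ α q = -α p ≫ P.d (p - 1) (q - 1)) ∧
      f.f 0 ≫ (HomologicalComplex.singleObjXSelf (ComplexShape.up ℤ) 0 (P.X 0)).hom =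
        α 0 ≫ P.d (0 - 1) 0 ∧
      mappingCone.inr f ≫ g.hom = fromSingleZero P hP := by
  have hα (p : ℤ) : ∃ a : (negPart P hP).X p ⟶ P.X (p - 1),
      a ≫ toNegPart P hP p = 𝟙 _ ∧ (p ≠ 1 → toNegPart P hP p ≫ a = 𝟙 _) := by
    by_cases hp : p = 1
    · exact ⟨0, (isZero_negPart_X P hP p (by omega)).eq_of_src _ _, fun h => (h hp).elim⟩
    · have := isIso_toNegPart P hP p hp
      exact ⟨inv (toNegPart P hP p), by simp, by simp⟩
  choose α hα₁ hα₂ using hα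
  have hd (p q : ℤ) (hp : p ≠ 1) (hq : q ≠ 1) :
      (negPart P hP).d p q ≫ α q = -α p ≫ P.d (p - 1) (q - 1) := by
    rw [← cancel_epi (toNegPart P hP p), ← Category.assoc, toNegPart_d]
    simp [hα₂ q hq, reassoc_of% (hα₂ p hp)]
  let f : negPart P hP ⟶ (HomologicalComplex.single C (ComplexShape.up ℤ) 0).obj (P.X 0) :=
    HomologicalComplex.mkHomToSingle (α 0 ≫ P.d (0 - 1) 0) (fun i hi => by
      rw [reassoc_of% (hd i 0 (by simp at hi; omega) (by omega))]
      simp)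
  have hf : f.f 0 ≫ (HomologicalComplex.singleObjXSelf (ComplexShape.up ℤ) 0 (P.X 0)).hom =
        α 0 ≫ P.d (0 - 1) 0 := by simp [f]
  let a : HomComplex.Cochain (negPart P hP) P (-1) :=
    HomComplex.Cochain.mk (fun p q hpq => α p ≫ (P.XIsoOfEq (by omega)).hom)
  have ha (p q : ℤ) (hpq : p + -1 = q) :
      a.v p q hpq = α p ≫ (P.XIsoOfEq (show p - 1 = q by omega)).hom := rfl
  have hδ : HomComplex.δ (-1) 0 a = HomComplex.Cochain.ofHom (f ≫ fromSingleZero P hP) := by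
    ext p
    rw [HomComplex.δ_v (-1) 0 (by omega) a p p (by omega) (p - 1) (p + 1) rfl rfl,
      HomComplex.Cochain.ofHom_v, HomologicalComplex.comp_f, ha, ha]
    rcases lt_trichotomy p 0 with hp | rfl | hp
    · rw [(isZero_single_X (P.X 0) p (by omega)).eq_of_tgt (f.f p) 0, zero_comp,
        reassoc_of% (hd p (p + 1) (by omega) (by omega))]
      simp
    · rw [(isZero_negPart_X P hP (0 + 1) (by omega)).eq_of_tgt ((negPart P hP).d 0 (0 + 1)) 0,
        fromSingleZero_f_zero, hf]
      simp
    · exact (isZero_negPart_X P hP p hp).eq_of_src _ _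
  let g : mappingCone f ⟶ P := mappingCone.desc f a (fromSingleZero P hP) hδ
  have hg : ∀ p, IsIso (g.f p) := fun p => by
    by_cases hp : p = 0
    · subst hp
      have hR := isZero_negPart_X P hP (0 + 1) (by omega)
      have : IsIso ((mappingCone.inr f).f 0) :=
        ⟨(mappingCone.snd f).v 0 0 (by omega), by simp, by
          rw [← mappingCone.id_X f 0 (0 + 1) rfl, hR.eq_of_tgt ((mappingCone.fst f).1.v _ _ _) 0]
          simp⟩
      have h : (mappingCone.inr f).f 0 ≫ g.f 0 = (fromSingleZero P hP).f 0 := by simp [g]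
      have : IsIso ((mappingCone.inr f).f 0 ≫ g.f 0) := by
        rw [h, fromSingleZero_f_zero]
        infer_instance
      exact IsIso.of_isIso_comp_left ((mappingCone.inr f).f 0) _
    · have hX := isZero_single_X (P.X 0) p hp
      have : IsIso ((mappingCone.inl f).v (p + 1) p (by omega)) :=
        ⟨(mappingCone.fst f).1.v p (p + 1) rfl, by simp, by
          rw [← mappingCone.id_X f p (p + 1) rfl, hX.eq_of_tgt ((mappingCone.snd f).v _ _ _) 0]
          simp⟩
      have h : (mappingCone.inl f).v (p + 1) p (by omega) ≫ g.f p = a.v (p + 1) p (by omega) := by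
        simp [g]
      have : IsIso (α (p + 1)) := ⟨_, hα₁ _, hα₂ _ (by omega)⟩
      have : IsIso ((mappingCone.inl f).v (p + 1) p (by omega) ≫ g.f p) := by
        rw [h, ha]
        infer_instance
      exact IsIso.of_isIso_comp_left ((mappingCone.inl f).v (p + 1) p _) _
  have : IsIso g := HomologicalComplex.Hom.isIso_of_components g
  exact ⟨negPart P hP, α, f, asIso g, isZero_negPart_X P hP,
    fun p hp => ⟨_, hα₁ _, hα₂ _ (by omega)⟩, fun p q hp hq => hd p q (by omega) (by omega), hf,
    by simp [g]⟩

end CochainComplex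

namespace DerivedCategory

variable {C : Type*} [Category C] [Abelian C] [HasDerivedCategory C]

/-- The morphism in the derived category induced by the inclusion of the degree zero term in a
complex concentrated in nonpositive degrees. -/
noncomputable def fromSingleZero (P : CochainComplex C ℤ)
    (hP : ∀ i : ℤ, 0 < i → IsZero (P.X i)) :
    (singleFunctor C 0).obj (P.X 0) ⟶ Q.obj P :=
  Q.map (P.fromSingleZero hP)

lemma exists_distinguished_triangle_fromSingleZero (P : CochainComplex C ℤ)
    (hP : ∀ i : ℤ, 0 < i → IsZero (P.X i)) :
    ∃ (R : CochainComplex C ℤ) (α : ∀ p, R.X p ⟶ P.X (p - 1))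
      (hR : ∀ p, 0 < p → IsZero (R.X p))
      (f : Q.obj R ⟶ (singleFunctor C 0).obj (P.X 0)) (h : Q.obj P ⟶ (Q.obj R)⟦(1 : ℤ)⟧),
      (∀ p, p ≤ 0 → IsIso (α p)) ∧
      (∀ p q, p ≤ 0 → q ≤ 0 → R.d p q ≫ α q = -α p ≫ P.d (p - 1) (q - 1)) ∧
      fromSingleZero R hR ≫ f = (singleFunctor C 0).map (α 0 ≫ P.d (0 - 1) 0) ∧
      Pretriangulated.Triangle.mk f (fromSingleZero P hP) h ∈ distTriang _ := by
  obtain ⟨R, α, f, g, hR, hα, hd, hf, hg⟩ := P.exists_mappingCone_iso hP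
  have hf' : R.fromSingleZero hR ≫ f =
      (HomologicalComplex.single C (ComplexShape.up ℤ) 0).map (α 0 ≫ P.d (0 - 1) 0) := by
    apply HomologicalComplex.from_single_hom_ext
    rw [HomologicalComplex.comp_f, CochainComplex.fromSingleZero_f_zero,
      HomologicalComplex.single_map_f_self, ← hf]
    simp
  have hT : Pretriangulated.Triangle.mk (Q.map f) (Q.map (P.fromSingleZero hP))
      (Q.map (g.inv ≫ (CochainComplex.mappingCone.triangle f).mor₃) ≫
        (Q.commShiftIso (1 : ℤ)).hom.app R) ∈ distTriang _ := by
    refine Pretriangulated.isomorphic_distinguished _ (mappingCone_triangle_distinguished f) _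
      (Pretriangulated.Triangle.isoMk _ _ (Iso.refl _) (Iso.refl _) (Q.mapIso g.symm) ?_ ?_ ?_)
    · exact (Category.comp_id _).trans (Category.id_comp _).symm
    · have hg' : P.fromSingleZero hP ≫ g.inv = CochainComplex.mappingCone.inr f := by
        rw [← hg, Category.assoc, g.hom_inv_id, Category.comp_id]
      exact ((Q.map_comp _ _).symm.trans (congrArg Q.map hg')).trans (Category.id_comp _).symm
    · refine (congrArg (_ ≫ ·) ((shiftFunctor _ (1 : ℤ)).map_id _)).trans ?_
      refine (Category.comp_id _).trans ?_
      exact (congrArg (· ≫ _) (Q.map_comp _ _)).trans (Category.assoc _ _ _)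
  exact ⟨R, α, hR, Q.map f, _, hα, hd, (Q.map_comp _ _).symm.trans (congrArg Q.map hf'), hT⟩

lemma hom_ext_fromSingleZero {P : CochainComplex C ℤ}
    (hP : ∀ i : ℤ, 0 < i → IsZero (P.X i)) {Y : C}
    {u v : Q.obj P ⟶ (singleFunctor C 0).obj Y}
    (huv : fromSingleZero P hP ≫ u = fromSingleZero P hP ≫ v) : u = v := by
  obtain ⟨R, _, hR, f, h, -, -, -, hT⟩ := exists_distinguished_triangle_fromSingleZero P hP
  rw [← sub_eq_zero]
  obtain ⟨w, hw⟩ : ∃ w : (Q.obj R)⟦(1 : ℤ)⟧ ⟶ (singleFunctor C 0).obj Y, u - v = h ≫ w :=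
    Pretriangulated.Triangle.yoneda_exact₃ _ hT (u - v)
      ((Preadditive.comp_sub _ _ _).trans (sub_eq_zero.2 huv))
  have : R.IsStrictlyLE 0 := (R.isStrictlyLE_iff 0).2 hR
  have : IsLE ((Q.obj R)⟦(1 : ℤ)⟧) (-1) := TStructure.t.isLE_shift _ 0 1 (-1)
  have hw₀ : w = 0 := TStructure.t.zero w (-1) 0
  rw [hw, hw₀, comp_zero]

lemma isZero_of_isZero_singleFunctor_obj {X : C} {n : ℤ}
    (hX : IsZero ((singleFunctor C n).obj X)) : IsZero X := by
  rw [IsZero.iff_id_eq_zero]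
  exact (singleFunctor C n).map_injective (hX.eq_of_src _ _)

lemma isZero_Q_obj {P : CochainComplex C ℤ} (hP : ∀ i : ℤ, IsZero (P.X i)) :
    IsZero (Q.obj P) := by
  refine Q.map_isZero ?_
  rw [IsZero.iff_id_eq_zero]
  ext i
  exact (hP i).eq_of_src _ _

variable {D : Type*} [Category D] [Abelian D] [HasDerivedCategory D]

lemma exists_iso_map_Q_obj (F : DerivedCategory C ⥤ DerivedCategory D) [F.CommShift ℤ]
    [F.IsTriangulated] (n : ℕ) (P : CochainComplex C ℤ) (K : CochainComplex D ℤ)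
    (hP : ∀ i : ℤ, 0 < i → IsZero (P.X i)) (hK : ∀ i : ℤ, 0 < i → IsZero (K.X i))
    (hP' : ∀ i : ℤ, i ≤ -(n : ℤ) → IsZero (P.X i)) (hK' : ∀ i : ℤ, i ≤ -(n : ℤ) → IsZero (K.X i))
    (e : ∀ i : ℤ, F.obj ((singleFunctor C 0).obj (P.X i)) ≅ (singleFunctor D 0).obj (K.X i))
    (he : ∀ i j : ℤ, F.map ((singleFunctor C 0).map (P.d i j)) ≫ (e j).hom =
      (e i).hom ≫ (singleFunctor D 0).map (K.d i j)) :
    ∃ φ : F.obj (Q.obj P) ≅ Q.obj K,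
      F.map (fromSingleZero P hP) ≫ φ.hom = (e 0).hom ≫ fromSingleZero K hK := by
  induction n generalizing P K with
  | zero =>
    have hPz (i : ℤ) : IsZero (P.X i) := (lt_or_ge 0 i).elim (hP i) fun h => hP' i (by simpa)
    have hKz (i : ℤ) : IsZero (K.X i) := (lt_or_ge 0 i).elim (hK i) fun h => hK' i (by simpa)
    exact ⟨(F.map_isZero (isZero_Q_obj hPz)).iso (isZero_Q_obj hKz),
      (isZero_Q_obj hKz).eq_of_tgt _ _⟩
  | succ n ih =>
    obtain ⟨R, α, hR, f, h, hα, hd, hf, hT⟩ := exists_distinguished_triangle_fromSingleZero P hP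
    obtain ⟨R', α', hR', f', h', hα', hd', hf', hT'⟩ :=
      exists_distinguished_triangle_fromSingleZero K hK
    have he' (p : ℤ) : ∃ e' : F.obj ((singleFunctor C 0).obj (R.X p)) ≅
        (singleFunctor D 0).obj (R'.X p), p ≤ 0 →
        e'.hom ≫ (singleFunctor D 0).map (α' p) =
          F.map ((singleFunctor C 0).map (α p)) ≫ (e (p - 1)).hom := by
      by_cases hp : p ≤ 0
      · have := hα p hp
        have := hα' p hp
        exact ⟨F.mapIso ((singleFunctor C 0).mapIso (asIso (α p))) ≪≫ e (p - 1) ≪≫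
          ((singleFunctor D 0).mapIso (asIso (α' p))).symm, fun _ => by
            simp⟩
      · exact ⟨(F.map_isZero ((singleFunctor C 0).map_isZero (hR p (by lia)))).iso
          ((singleFunctor D 0).map_isZero (hR' p (by lia))), fun h => (hp h).elim⟩
    choose e' he' using he'
    obtain ⟨φ, hφ⟩ := ih R R' hR hR'
      (fun i hi => by
        have := hα i (by lia)
        exact (hP' (i - 1) (by lia)).of_iso (asIso (α i)))
      (fun i hi => by
        have := hα' i (by lia)
        exact (hK' (i - 1) (by lia)).of_iso (asIso (α' i))) e' (fun i j => by
        rcases lt_or_ge 0 j with hj | hj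
        · exact ((singleFunctor D 0).map_isZero (hR' j hj)).eq_of_tgt _ _
        rcases lt_or_ge 0 i with hi | hi
        · exact (F.map_isZero ((singleFunctor C 0).map_isZero (hR i hi))).eq_of_src _ _
        have := hα' j hj
        rw [← cancel_mono ((singleFunctor D 0).map (α' j)), Category.assoc, Category.assoc,
          he' j hj, ← Functor.map_comp, hd' i j hi hj, ← F.map_comp_assoc, ← Functor.map_comp,
          hd i j hi hj]
        simp only [Functor.map_neg, Functor.map_comp, Preadditive.neg_comp, Preadditive.comp_neg,
          Category.assoc, he]
        rw [reassoc_of% (he' i hi)])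
    have comm : F.map f ≫ (e 0).hom = φ.hom ≫ f' := by
      rw [← cancel_epi φ.inv]
      apply hom_ext_fromSingleZero hR'
      have hφ' : fromSingleZero R' hR' ≫ φ.inv = (e' 0).inv ≫ F.map (fromSingleZero R hR) := by
        rw [Iso.comp_inv_eq, Category.assoc, hφ, Iso.inv_hom_id_assoc]
      rw [reassoc_of% hφ', Iso.inv_hom_id_assoc, ← F.map_comp_assoc, hf, hf', Iso.inv_comp_eq]
      simp only [Functor.map_comp, Category.assoc, he]
      rw [reassoc_of% (he' 0 le_rfl)]
    let iso := Pretriangulated.isoTriangleOfIso₁₂ _ _ (F.map_distinguished _ hT) hT' φ (e 0) comm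
    exact ⟨Pretriangulated.Triangle.π₃.mapIso iso, iso.hom.comm₂⟩

end DerivedCategory

theorem statement11 {A B : Type*} [Category A] [Category B] [Abelian A] [Abelian B]
    [HasDerivedCategory A] [HasDerivedCategory B]
    -- the triangulated functor `F : D(A) ⥤ D(B)`:
    (F : DerivedCategory A ⥤ DerivedCategory B)
    [F.CommShift ℤ] [F.IsTriangulated]
    -- the resolution `0 → P^{-n} → ... → P⁰ → M → 0`:
    (n : ℕ) (P : CochainComplex A ℤ)
    (hsupp : ∀ i : ℤ, (i < -(n : ℤ) ∨ 0 < i) → IsZero (P.X i))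
    (M : A)
    (ε : P ⟶ (HomologicalComplex.single A (ComplexShape.up ℤ) 0).obj M)
    (hqis : QuasiIso ε)
    -- each `F(P^i)` lies in the heart of the standard t-structure:
    (hheart : ∀ i : ℤ, ∃ b : B,
      Nonempty (F.obj ((DerivedCategory.singleFunctor A 0).obj (P.X i)) ≅
        (DerivedCategory.singleFunctor B 0).obj b)) :
    -- conclusion: there is a complex `F̂(P) = K` in `B`, concentrated in degrees
    -- `[-n, 0]`, whose components are the `F(P^i)` and whose differentials are
    -- obtained by applying `F` to those of `P`, with `F(M) ≅ F̂(P)` in `D(B)`: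
    ∃ (K : CochainComplex B ℤ)
      (e : ∀ i : ℤ, F.obj ((DerivedCategory.singleFunctor A 0).obj (P.X i)) ≅
        (DerivedCategory.singleFunctor B 0).obj (K.X i)),
      (∀ i : ℤ, (i < -(n : ℤ) ∨ 0 < i) → IsZero (K.X i))
      ∧ (∀ i j : ℤ,
          F.map ((DerivedCategory.singleFunctor A 0).map (P.d i j)) ≫ (e j).hom =
            (e i).hom ≫ (DerivedCategory.singleFunctor B 0).map (K.d i j))
      ∧ Nonempty (F.obj ((DerivedCategory.singleFunctor A 0).obj M) ≅
          DerivedCategory.Q.obj K) := by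
  choose b e using hheart
  let e' (i : ℤ) := (e i).some
  let S := DerivedCategory.singleFunctor B 0
  let d (i j : ℤ) : b i ⟶ b j := S.preimage
    ((e' i).inv ≫ F.map ((DerivedCategory.singleFunctor A 0).map (P.d i j)) ≫ (e' j).hom)
  have hd (i j : ℤ) : S.map (d i j) =
      (e' i).inv ≫ F.map ((DerivedCategory.singleFunctor A 0).map (P.d i j)) ≫ (e' j).hom :=
    S.map_preimage _
  let K : CochainComplex B ℤ :=
    { X := b
      d := d
      shape := fun i j hij => S.map_injective (by
        rw [hd, P.shape i j hij]
        simp)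
      d_comp_d' := fun i j k _ _ => S.map_injective (by
        rw [S.map_comp, hd, hd]
        simp only [Category.assoc, Iso.hom_inv_id_assoc]
        rw [← F.map_comp_assoc, ← Functor.map_comp, P.d_comp_d]
        simp) }
  have hK (i : ℤ) (hi : i < -(n : ℤ) ∨ 0 < i) : IsZero (K.X i) :=
    DerivedCategory.isZero_of_isZero_singleFunctor_obj
      ((F.map_isZero (Functor.map_isZero _ (hsupp i hi))).of_iso (e' i).symm)
  have he (i j : ℤ) : F.map ((DerivedCategory.singleFunctor A 0).map (P.d i j)) ≫ (e' j).hom =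
      (e' i).hom ≫ S.map (K.d i j) := by
    rw [← Iso.inv_comp_eq]
    exact (hd i j).symm
  obtain ⟨φ, -⟩ := DerivedCategory.exists_iso_map_Q_obj F (n + 1) P K
    (fun i hi => hsupp i (Or.inr hi)) (fun i hi => hK i (Or.inr hi))
    (fun i hi => hsupp i (Or.inl (by push_cast at hi; lia)))
    (fun i hi => hK i (Or.inl (by push_cast at hi; lia))) e' he
  exact ⟨K, e', hK, he, ⟨F.mapIso (asIso (DerivedCategory.Q.map ε)).symm ≪≫ φ⟩⟩
end
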